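/- Let a, b : ℤ → ℝ be such that the Hurwitz-type matrix H(a,b) is totally nonnegative, and let A, B ≥ 0 be real numbers. Define c, d : ℤ → ℝ by c_k = A·a_k + B·b_k (the coefficients of A·p(z) + B·q(z)) and d_k = A·b_k + B·a_{k−1} (the coefficients of A·q(z) + B·z·p(z)). Then both Toeplitz matrices T(c) and T(d) are totally nonnegative. -/

import Mathlib

/-- A doubly infinite real matrix is totally nonnegative if all its minors
(with rows and columns selected in increasing order) are nonnegative. -/
def TotallyNonneg (M : ℤ → ℤ → ℝ) : Prop :=
  ∀ (k : ℕ) (i j : Fin k → ℤ), StrictMono i → StrictMono j →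
    0 ≤ (Matrix.of fun r s => M (i r) (j s)).det

/-- The doubly infinite Toeplitz matrix of a sequence `c : ℤ → ℝ`. -/
def toeplitz (c : ℤ → ℝ) : ℤ → ℤ → ℝ := fun i j => c (j - i)

/-- The doubly infinite Hurwitz-type matrix of two sequences `a b : ℤ → ℝ`:
row `2m` is `j ↦ a (j - m)` and row `2m+1` is `j ↦ b (j - m)`. -/
def hurwitz (a b : ℤ → ℝ) : ℤ → ℤ → ℝ :=
  fun i j => if 2 ∣ i then a (j - i / 2) else b (j - (i - 1) / 2)

/-- Combining rows `2 * i + t` and `2 * i + t + 1` with nonnegative weights preserves total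
nonnegativity. -/
theorem TotallyNonneg.combine_adjacent_rows {M : ℤ → ℤ → ℝ} (hM : TotallyNonneg M)
    {A B : ℝ} (hA : 0 ≤ A) (hB : 0 ≤ B) (t : ℤ) :
    TotallyNonneg (fun i j => A * M (2 * i + t) j + B * M (2 * i + t + 1) j) := by
  intro k i j hi hj
  have expand := (Matrix.detRowAlternating (n := Fin k) (R := ℝ)).toMultilinearMap.map_add_univ
    (fun r s => A * M (2 * i r + t) (j s)) (fun r s => B * M (2 * i r + t + 1) (j s))
  refine le_of_le_of_eq (Finset.sum_nonneg fun S _ => ?_) expand.symm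
  have rows : S.piecewise (fun r s => A * M (2 * i r + t) (j s))
      (fun r s => B * M (2 * i r + t + 1) (j s)) =
      Matrix.of fun r s => (if r ∈ S then A else B) *
        (Matrix.of fun r s => M (if r ∈ S then 2 * i r + t else 2 * i r + t + 1) (j s)) r s := by
    ext r s
    by_cases h : r ∈ S <;> simp [h]
  rw [rows]
  refine le_of_le_of_eq ?_ (Matrix.det_mul_column _ _).symm
  refine mul_nonneg (Finset.prod_nonneg fun r _ => by split_ifs <;> assumption)
    (hM k _ j (fun r s hrs => ?_) hj)
  have := hi hrs
  split_ifs <;> omega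

theorem hurwitz_even (a b : ℤ → ℝ) (m j : ℤ) : hurwitz a b (2 * m) j = a (j - m) := by
  simp [hurwitz]

theorem hurwitz_odd (a b : ℤ → ℝ) (m j : ℤ) : hurwitz a b (2 * m + 1) j = b (j - m) := by
  have h : ¬ (2 : ℤ) ∣ 2 * m + 1 := by omega
  simp [hurwitz, h]

theorem stmt15 (a b : ℤ → ℝ) (hH : TotallyNonneg (hurwitz a b))
    (A B : ℝ) (hA : 0 ≤ A) (hB : 0 ≤ B) :
    TotallyNonneg (toeplitz (fun k => A * a k + B * b k)) ∧
    TotallyNonneg (toeplitz (fun k => A * b k + B * a (k - 1))) := by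
  constructor
  · convert hH.combine_adjacent_rows hA hB 0 using 3 with i j
    simp [toeplitz, hurwitz_even, hurwitz_odd]
  · convert hH.combine_adjacent_rows hA hB 1 using 3 with i j
    rw [show 2 * i + 1 + 1 = 2 * (i + 1) by ring, hurwitz_even, hurwitz_odd, toeplitz,
      sub_sub]
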